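/- arXiv:1907.09800 — 2 statements merged into one kernel-verified Lean document; each statement's English description precedes it below -/
import Mathlib

section
/- Let p, q ≥ 0, let B be a p×(p+q) complex matrix and C a (p+q)×p complex matrix, and let M be the (2p+q)×(2p+q) block matrix M = [[0, B],[C, 0]] (zero blocks of sizes p×p and (p+q)×(p+q)). Then the characteristic polynomial of M factors as charpoly(M) = X^q · (charpoly(B·C)).comp(X²), where B·C is the p×p product matrix. -/
open Polynomial

namespace Matrix

variable {R m n : Type*} [CommRing R] [Fintype m] [DecidableEq m] [Fintype n] [DecidableEq n]

/-- Substituting `p` in the characteristic polynomial of `A` gives `det (p • 1 - A)`. -/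
theorem charpoly_comp (A : Matrix m m R) (p : R[X]) :
    A.charpoly.comp p = (scalar m p - A.map C).det := by
  rw [charpoly, ← coe_compRingHom_apply, RingHom.map_det]
  congr 1
  ext i j : 1
  by_cases hij : i = j
  · subst hij
    simp
  · simp [hij]

/-- The characteristic polynomial of a block anti-diagonal matrix, up to powers of `X`. -/
theorem X_pow_mul_charpoly_fromBlocks_zero_zero (A : Matrix m n R) (B : Matrix n m R) :
    X ^ Fintype.card m * (fromBlocks 0 A B 0).charpoly =
      X ^ Fintype.card n * (A * B).charpoly.comp (X ^ 2) := by
  let N : Matrix (m ⊕ n) (m ⊕ n) R[X] := fromBlocks (scalar m X) 0 (B.map C) 1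
  have hN : charmatrix (fromBlocks 0 A B 0) * N =
      fromBlocks (scalar m (X ^ 2) - (A * B).map C) (-A.map C) 0 (scalar n X) := by
    rw [charmatrix_fromBlocks]
    simp only [N, fromBlocks_multiply, charmatrix_zero]
    congr 1
    · simp [sub_eq_add_neg, sq]
    · simp
    · rw [Matrix.neg_mul, ← scalar_comm X (fun r => Commute.all X r), neg_add_cancel]
    · simp
  have hdet := congrArg det hN
  rw [det_mul, det_fromBlocks_zero₂₁, ← charpoly_comp] at hdet
  simpa [N, charpoly, mul_comm] using hdet

end Matrix

/-- For `B` a `p×(p+q)` and `C` a `(p+q)×p` complex matrix, the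
characteristic polynomial of the block matrix `M = [[0,B],[C,0]]` factors as
`charpoly M = X^q * (charpoly (B·C)).comp (X²)`. -/
theorem charpoly_offdiag_block (p q : ℕ)
    (B : Matrix (Fin p) (Fin (p + q)) ℂ) (C : Matrix (Fin (p + q)) (Fin p) ℂ) :
    Matrix.charpoly
        (Matrix.fromBlocks (0 : Matrix (Fin p) (Fin p) ℂ) B C
          (0 : Matrix (Fin (p + q)) (Fin (p + q)) ℂ)) =
      X ^ q * (Matrix.charpoly (B * C)).comp (X ^ 2) := by
  refine (Polynomial.isRegular_X_pow p).left.eq_iff.mp ?_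
  have h := Matrix.X_pow_mul_charpoly_fromBlocks_zero_zero B C
  simp only [Fintype.card_fin] at h
  rw [h, pow_add, mul_assoc]
end

section
/- Let n ≥ 0, let J be the standard symplectic 2n×2n matrix (the block matrix with blocks [[0, 1],[−1, 0]] of size n), and let A be a 2n×2n complex matrix satisfying Aᵀ·J = J·A (i.e., A is self-adjoint with respect to the standard symplectic form). Then there exists a monic polynomial p ∈ ℂ[X] of degree n such that charpoly(A) = p². -/
open Polynomial

/-- The standard symplectic `2n×2n` matrix, with blocks `[[0, 1], [-1, 0]]`. -/
def sympJ (n : ℕ) : Matrix (Fin n ⊕ Fin n) (Fin n ⊕ Fin n) ℂ :=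
  Matrix.fromBlocks 0 1 (-1) 0

/-- The determinant of a skew-symmetric matrix over a field of characteristic not two is a
square. -/
theorem Matrix.isSquare_det_of_transpose_eq_neg {K : Type*} [Field K] (h2 : (2 : K) ≠ 0)
    {ι : Type*} [Fintype ι] [DecidableEq ι] (M : Matrix ι ι K) (hM : M.transpose = -M) :
    IsSquare M.det := by
  classical
  induction hk : Fintype.card ι using Nat.strong_induction_on generalizing ι with
  | _ k ih =>
  have hskew : ∀ i j, M i j = -M j i := fun i j => congrFun (congrFun hM j) i
  have hdiag : ∀ i, M i i = 0 := fun i => by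
    have h : 2 * M i i = 0 := by linear_combination hskew i i
    exact (mul_eq_zero.mp h).resolve_left h2
  rcases isEmpty_or_nonempty ι with hι | ⟨⟨i⟩⟩
  · rw [Matrix.det_isEmpty]
    exact IsSquare.one
  by_cases hrow : ∀ j, M i j = 0
  · rw [Matrix.det_eq_zero_of_row_eq_zero i hrow]
    exact IsSquare.zero
  push Not at hrow
  obtain ⟨j, hj⟩ := hrow
  have hij : i ≠ j := by
    rintro rfl
    exact hj (hdiag i)
  have hf : Function.Injective ![i, j] := by
    intro a b
    fin_cases a <;> fin_cases b <;> simp [hij, hij.symm]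
  let e : Fin 2 ⊕ ↥(Set.range ![i, j])ᶜ ≃ ι :=
    ((Equiv.ofInjective _ hf).sumCongr (Equiv.refl _)).trans (Equiv.Set.sumCompl _)
  set N := M.submatrix e e with hN
  have hNskew : ∀ a b, N a b = -N b a := fun a b => hskew _ _
  have hdetA : N.toBlocks₁₁.det = M i j * M i j := by
    have h00 : N.toBlocks₁₁ 0 0 = 0 := hdiag _
    have h01 : N.toBlocks₁₁ 0 1 = M i j := rfl
    have h10 : N.toBlocks₁₁ 1 0 = -M i j := hskew j i
    rw [Matrix.det_fin_two, h00, h01, h10]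
    ring
  have hunit : IsUnit N.toBlocks₁₁.det := by
    rw [hdetA]
    exact (mul_ne_zero hj hj).isUnit
  let _ : Invertible N.toBlocks₁₁ := N.toBlocks₁₁.invertibleOfIsUnitDet hunit
  have h11 : N.toBlocks₁₁.transpose = -N.toBlocks₁₁ := by
    ext a b
    exact hNskew _ _
  have h12 : N.toBlocks₁₂.transpose = -N.toBlocks₂₁ := by
    ext a b
    exact hNskew _ _
  have h21 : N.toBlocks₂₁.transpose = -N.toBlocks₁₂ := by
    ext a b
    exact hNskew _ _
  have h22 : N.toBlocks₂₂.transpose = -N.toBlocks₂₂ := by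
    ext a b
    exact hNskew _ _
  have hinv : (-N.toBlocks₁₁)⁻¹ = -N.toBlocks₁₁⁻¹ := by
    apply Matrix.inv_eq_left_inv
    rw [neg_mul_neg, Matrix.nonsing_inv_mul _ hunit]
  have hcard : Fintype.card ↥(Set.range ![i, j])ᶜ < k := by
    have := Fintype.card_congr e
    rw [Fintype.card_sum, Fintype.card_fin] at this
    omega
  have hS := ih _ hcard
    (N.toBlocks₂₂ - N.toBlocks₂₁ * ⅟N.toBlocks₁₁ * N.toBlocks₁₂) (by
      rw [Matrix.invOf_eq_nonsing_inv, Matrix.transpose_sub, Matrix.transpose_mul,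
        Matrix.transpose_mul, Matrix.transpose_nonsing_inv, h11, h12, h21, h22, hinv]
      simp only [Matrix.neg_mul, Matrix.mul_neg, neg_neg, Matrix.mul_assoc]
      abel) rfl
  rw [← Matrix.det_submatrix_equiv_self e M, ← hN, ← Matrix.fromBlocks_toBlocks N,
    Matrix.det_fromBlocks₁₁, hdetA]
  exact (IsSquare.mul_self _).mul hS

/-- An element of an integrally closed domain which becomes a square in the fraction field is a
square. -/
theorem IsIntegrallyClosed.isSquare_of_isSquare_algebraMap {R K : Type*} [CommRing R] [IsDomain R]
    [IsIntegrallyClosed R] [Field K] [Algebra R K] [IsFractionRing R K] {d : R}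
    (hd : IsSquare (algebraMap R K d)) : IsSquare d := by
  obtain ⟨r, hr⟩ := hd
  have hint : IsIntegral R (r ^ 2) := by
    rw [sq, ← hr]
    exact isIntegral_algebraMap
  obtain ⟨q, rfl⟩ := IsIntegrallyClosed.exists_algebraMap_eq_of_isIntegral_pow two_pos hint
  exact ⟨q, IsFractionRing.injective R K (by rw [hr, map_mul])⟩

theorem sympJ_transpose (n : ℕ) : (sympJ n).transpose = -sympJ n := by
  simp [sympJ, Matrix.fromBlocks_transpose, Matrix.fromBlocks_neg]

theorem sympJ_det_ne_zero (n : ℕ) : (sympJ n).det ≠ 0 := by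
  have h : sympJ n * -sympJ n = 1 := by
    simp [sympJ, Matrix.fromBlocks_neg, Matrix.fromBlocks_multiply]
  exact ((Matrix.isUnit_iff_isUnit_det _).mp (IsUnit.of_mul_eq_one _ h)).ne_zero

/-- If `A` is a `2n×2n` complex matrix with `Aᵀ·J = J·A` (self-adjoint
for the standard symplectic form), then `charpoly A` is the square of a monic
polynomial of degree `n`. -/
theorem symplectic_selfadjoint_charpoly_sq (n : ℕ)
    (A : Matrix (Fin n ⊕ Fin n) (Fin n ⊕ Fin n) ℂ)
    (hA : A.transpose * sympJ n = sympJ n * A) :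
    ∃ p : Polynomial ℂ, p.Monic ∧ p.natDegree = n ∧ Matrix.charpoly A = p ^ 2 := by
  set B : Matrix (Fin n ⊕ Fin n) (Fin n ⊕ Fin n) ℂ[X] := C.mapMatrix (sympJ n) * A.charmatrix
    with hB
  have hBt : B.transpose = -B := by
    have hJ : (C.mapMatrix (sympJ n)).transpose = -C.mapMatrix (sympJ n) := by
      rw [← map_neg, ← sympJ_transpose]
      rfl
    have hAJ : (C.mapMatrix A).transpose * C.mapMatrix (sympJ n) =
        C.mapMatrix (sympJ n) * C.mapMatrix A := by
      rw [← map_mul, ← hA, map_mul]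
      rfl
    rw [hB, Matrix.transpose_mul, hJ, Matrix.charmatrix, Matrix.transpose_sub, mul_neg, sub_mul,
      hAJ, mul_sub, Matrix.scalar_apply, Matrix.diagonal_transpose, ← Matrix.scalar_apply,
      (Matrix.scalar_commute X (Commute.all X) (C.mapMatrix (sympJ n))).eq]
  have hBdet : B.det = C (sympJ n).det * A.charpoly := by
    rw [hB, Matrix.det_mul, ← RingHom.map_det, Matrix.charpoly]
  have hsq : IsSquare B.det := by
    apply IsIntegrallyClosed.isSquare_of_isSquare_algebraMap (K := FractionRing ℂ[X])
    rw [RingHom.map_det]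
    apply Matrix.isSquare_det_of_transpose_eq_neg two_ne_zero
    rw [← map_neg, ← hBt]
    rfl
  obtain ⟨q, hq⟩ := hsq
  rw [hBdet] at hq
  have hlc : (sympJ n).det = q.leadingCoeff * q.leadingCoeff := by
    have h := congrArg leadingCoeff hq
    rwa [leadingCoeff_mul, leadingCoeff_mul, leadingCoeff_C, A.charpoly_monic.leadingCoeff,
      mul_one] at h
  have hlc0 : q.leadingCoeff ≠ 0 := fun h => sympJ_det_ne_zero n (by rw [hlc, h, mul_zero])
  have hmonic : (C q.leadingCoeff⁻¹ * q).Monic := by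
    rw [Monic, leadingCoeff_mul, leadingCoeff_C, inv_mul_cancel₀ hlc0]
  have hchar : A.charpoly = (C q.leadingCoeff⁻¹ * q) ^ 2 := by
    have hC : C q.leadingCoeff⁻¹ * C q.leadingCoeff = 1 := by
      rw [← C_mul, inv_mul_cancel₀ hlc0, C_1]
    rw [hlc, C_mul] at hq
    linear_combination C q.leadingCoeff⁻¹ ^ 2 * hq -
      A.charpoly * (C q.leadingCoeff⁻¹ * C q.leadingCoeff + 1) * hC
  refine ⟨_, hmonic, ?_, hchar⟩
  have hdeg := congrArg natDegree hchar
  rw [natDegree_pow, Matrix.charpoly_natDegree_eq_dim, Fintype.card_sum, Fintype.card_fin] at hdeg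
  omega
end
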